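/- arXiv:2002.06100 — 6 statements merged into one kernel-verified Lean document; each statement's English description precedes it below -/
import Mathlib

section
/- Let g : ℝ^n → ℝ be differentiable and single-passing, and for each i = 1,…,n let y_i : ℝ^{m_i} → ℝ be differentiable and single-passing. Then the composite function h : ℝ^{m_1} × ⋯ × ℝ^{m_n} → ℝ defined by h(X_1,…,X_n) = g(y_1(X_1),…,y_n(X_n)), whose input variables are the disjoint union of the input variables of the y_i, is single-passing. -/
/-- A differentiable function `f : ℝ^ι → ℝ` is *single-passing* if at every point
at most one of its partial derivatives is nonzero. -/
def SinglePassing {ι : Type*} [Fintype ι] [DecidableEq ι] (f : (ι → ℝ) → ℝ) : Prop :=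
  ∀ x : ι → ℝ, {i : ι | fderiv ℝ f x (Pi.single i 1) ≠ 0}.Subsingleton

/-- Any composition of single-passing functions is single-passing. -/
theorem singlePassing_comp (n : ℕ) (m : Fin n → ℕ)
    (g : (Fin n → ℝ) → ℝ) (hg : Differentiable ℝ g) (hgsp : SinglePassing g)
    (y : ∀ i : Fin n, (Fin (m i) → ℝ) → ℝ)
    (hy : ∀ i, Differentiable ℝ (y i)) (hysp : ∀ i, SinglePassing (y i)) :
    SinglePassing (fun X : (Σ i : Fin n, Fin (m i)) → ℝ =>
      g (fun i => y i (fun j => X ⟨i, j⟩))) := by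
  intro X
  let Y : Fin n → ℝ := fun i => y i (fun j => X ⟨i, j⟩)
  let P : ∀ i : Fin n, ((Σ i : Fin n, Fin (m i)) → ℝ) →L[ℝ] (Fin (m i) → ℝ) := fun i =>
    ContinuousLinearMap.pi fun j => ContinuousLinearMap.proj (⟨i, j⟩ : Σ i : Fin n, Fin (m i))
  have hP : ∀ i, HasFDerivAt (fun X : (Σ i : Fin n, Fin (m i)) → ℝ => y i (fun j => X ⟨i, j⟩))
      ((fderiv ℝ (y i) (fun j => X ⟨i, j⟩)).comp (P i)) X := fun i =>
    HasFDerivAt.comp (f := fun X => P i X) X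
      ((hy i (fun j => X ⟨i, j⟩)).hasFDerivAt) (P i).hasFDerivAt
  have hh : HasFDerivAt (fun X : (Σ i : Fin n, Fin (m i)) → ℝ =>
      g (fun i => y i (fun j => X ⟨i, j⟩)))
      ((fderiv ℝ g Y).comp (ContinuousLinearMap.pi fun i =>
        (fderiv ℝ (y i) (fun j => X ⟨i, j⟩)).comp (P i))) X :=
    HasFDerivAt.comp (f := fun (X : (Σ i : Fin n, Fin (m i)) → ℝ) (i : Fin n) =>
      y i (fun j => X ⟨i, j⟩)) X ((hg Y).hasFDerivAt) (hasFDerivAt_pi.2 hP)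
  have hP1 : ∀ i j, P i (Pi.single ⟨i, j⟩ 1) = Pi.single j 1 := by
    intro i j
    ext k
    by_cases hk : k = j
    · subst hk; simp [P]
    · simp [P, Pi.single_apply, hk]
  have hP2 : ∀ i i' j, i' ≠ i → P i' (Pi.single ⟨i, j⟩ 1) = 0 := by
    intro i i' j hne
    ext k
    simp [P, Pi.single_apply, hne]
  have key : ∀ i j, fderiv ℝ (fun X : (Σ i : Fin n, Fin (m i)) → ℝ =>
      g (fun i => y i (fun j => X ⟨i, j⟩))) X (Pi.single ⟨i, j⟩ 1) =
      fderiv ℝ (y i) (fun j => X ⟨i, j⟩) (Pi.single j 1) * fderiv ℝ g Y (Pi.single i 1) := by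
    intro i j
    rw [hh.fderiv, ContinuousLinearMap.comp_apply, ← smul_eq_mul, ← map_smul]
    congr 1
    ext i'
    by_cases h : i' = i
    · subst h
      simp [hP1]
    · simp [hP2 i i' j h, h]
  rintro ⟨i, j⟩ h1 ⟨i', j'⟩ h2
  rw [Set.mem_setOf_eq, key] at h1 h2
  obtain rfl : i = i' := hgsp Y (right_ne_zero_of_mul h1) (right_ne_zero_of_mul h2)
  obtain rfl : j = j' := hysp i _ (left_ne_zero_of_mul h1) (left_ne_zero_of_mul h2)
  rfl
end

section
/- For every n ≥ 2, the n-dimensional Lebesgue measure of the set {x ∈ [0,1]^n : x_i + x_j > 1 for all i ≠ j} equals 1/2^{n−1}. (The condition x_i + x_j > 1 for all i ≠ j is equivalent to requiring that the sum of the two smallest coordinates of x exceeds 1.) -/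
open MeasureTheory

/-- A slab: one small coordinate, all the others above its reflection. -/
def slabSet (m : ℕ) : Set (ℝ × (Fin m → ℝ)) :=
  {p | p.1 ∈ Set.Icc (0 : ℝ) (1/2) ∧ ∀ j, p.2 j ∈ Set.Ioc (1 - p.1) 1}

lemma measurableSet_slabSet (m : ℕ) : MeasurableSet (slabSet m) := by
  have h : slabSet m = {p | 0 ≤ p.1} ∩ {p | p.1 ≤ 1/2} ∩
      ⋂ j, ({p : ℝ × (Fin m → ℝ) | 1 - p.1 < p.2 j} ∩ {p | p.2 j ≤ 1}) := by
    ext p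
    simp [slabSet]
  rw [h]
  refine ((measurableSet_le ?_ ?_).inter (measurableSet_le ?_ ?_)).inter
    (MeasurableSet.iInter fun j => (measurableSet_lt ?_ ?_).inter (measurableSet_le ?_ ?_)) <;>
    fun_prop

lemma volume_slabSet (m : ℕ) :
    volume (slabSet m) = ENNReal.ofReal ((1/2) ^ (m+1) / (m+1)) := by
  rw [Measure.volume_eq_prod, Measure.prod_apply (measurableSet_slabSet m)]
  have h : ∀ t : ℝ, volume (Prod.mk t ⁻¹' slabSet m) =
      (Set.Icc (0:ℝ) (1/2)).indicator (fun t => ENNReal.ofReal (t ^ m)) t := by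
    intro t
    by_cases ht : t ∈ Set.Icc (0:ℝ) (1/2)
    · rw [Set.indicator_of_mem ht]
      have : Prod.mk t ⁻¹' slabSet m = Set.pi Set.univ (fun _ : Fin m => Set.Ioc (1 - t) 1) := by
        ext y
        simp only [slabSet, Set.mem_preimage, Set.mem_ofPred_eq, Set.mem_pi, Set.mem_univ,
          true_imp_iff]
        exact ⟨fun h => h.2, fun h => ⟨ht, h⟩⟩
      rw [this, volume_pi_pi]
      simp [ENNReal.ofReal_pow ht.1]
    · rw [Set.indicator_of_notMem ht]
      have : Prod.mk t ⁻¹' slabSet m = ∅ := by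
        ext y
        simp only [slabSet, Set.mem_preimage, Set.mem_ofPred_eq, Set.mem_empty_iff_false, iff_false]
        exact fun h => ht h.1
      rw [this, measure_empty]
  simp_rw [h]
  rw [lintegral_indicator measurableSet_Icc, ← ofReal_integral_eq_lintegral_ofReal]
  · rw [integral_Icc_eq_integral_Ioc, ← intervalIntegral.integral_of_le (by norm_num),
      integral_pow]
    simp
  · exact (continuous_pow m).continuousOn.integrableOn_Icc
  · exact (ae_restrict_iff' measurableSet_Icc).2 (Filter.Eventually.of_forall
      fun t ht => pow_nonneg ht.1 m)

/-- The fraction of inputs `x ∈ [0,1]^n` for which `x i + x j > 1` for all `i ≠ j`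
(equivalently, the sum of the two smallest coordinates exceeds 1) equals `1/2^(n-1)`. -/
theorem volume_nilpotent_nonvanishing (n : ℕ) (hn : 2 ≤ n) :
    volume {x : Fin n → ℝ |
        (∀ i, x i ∈ Set.Icc (0 : ℝ) 1) ∧ ∀ i j, i ≠ j → 1 < x i + x j}
      = 1 / 2 ^ (n - 1) := by
  obtain ⟨m, rfl⟩ : ∃ m, n = m + 1 := ⟨n - 1, by omega⟩
  let A : Set (Fin (m+1) → ℝ) := Set.pi Set.univ (fun _ => Set.Ioc (1/2) 1)
  let B : Fin (m+1) → Set (Fin (m+1) → ℝ) := fun k =>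
    (MeasurableEquiv.piFinSuccAbove (fun _ => ℝ) k) ⁻¹' slabSet m
  have hB : ∀ k x, x ∈ B k ↔ x k ∈ Set.Icc (0:ℝ) (1/2) ∧
      ∀ j, j ≠ k → x j ∈ Set.Ioc (1 - x k) 1 := by
    intro k x
    have : x ∈ B k ↔ x k ∈ Set.Icc (0:ℝ) (1/2) ∧
      ∀ j, x (k.succAbove j) ∈ Set.Ioc (1 - x k) 1 := Iff.rfl
    rw [this]
    refine and_congr_right fun _ => ⟨fun h j hj => ?_, fun h j => h _ (Fin.succAbove_ne k j)⟩
    obtain ⟨i, rfl⟩ := Fin.exists_succAbove_eq hj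
    exact h i
  have hBm : ∀ k, MeasurableSet (B k) := fun k =>
    (MeasurableEquiv.measurable _) (measurableSet_slabSet m)
  have hBv : ∀ k, volume (B k) = ENNReal.ofReal ((1/2) ^ (m+1) / (m+1)) := fun k => by
    rw [← volume_slabSet]
    exact (volume_preserving_piFinSuccAbove (fun _ => ℝ) k).measure_preimage
      (measurableSet_slabSet m).nullMeasurableSet
  have hS : {x : Fin (m+1) → ℝ |
        (∀ i, x i ∈ Set.Icc (0 : ℝ) 1) ∧ ∀ i j, i ≠ j → 1 < x i + x j} = A ∪ ⋃ k, B k := by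
    ext x
    simp only [Set.mem_union, Set.mem_iUnion, hB, A, Set.mem_pi, Set.mem_univ, true_imp_iff,
      Set.mem_ofPred_eq, Set.mem_Icc, Set.mem_Ioc]
    constructor
    · rintro ⟨h1, h2⟩
      by_cases h : ∀ i, 1/2 < x i
      · exact Or.inl fun i => ⟨h i, (h1 i).2⟩
      · push Not at h
        obtain ⟨k, hk⟩ := h
        refine Or.inr ⟨k, ⟨(h1 k).1, hk⟩, fun j hj => ⟨?_, (h1 j).2⟩⟩
        linarith [h2 j k hj]
    · rintro (h | ⟨k, hk, h⟩)
      · exact ⟨fun i => ⟨by linarith [(h i).1], (h i).2⟩,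
          fun i j _ => by linarith [(h i).1, (h j).1]⟩
      · refine ⟨fun i => ?_, fun i j hij => ?_⟩
        · by_cases hi : i = k
          · subst hi; exact ⟨hk.1, by linarith [hk.2]⟩
          · exact ⟨by linarith [(h i hi).1, hk.2], (h i hi).2⟩
        · by_cases hi : i = k
          · subst hi; linarith [(h j hij.symm).1]
          · by_cases hj : j = k
            · subst hj; linarith [(h i hi).1]
            · linarith [(h i hi).1, (h j hj).1, hk.2]
  have hAB : Disjoint A (⋃ k, B k) := by
    rw [Set.disjoint_left]
    intro x hx hx'
    obtain ⟨k, hk⟩ := Set.mem_iUnion.1 hx'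
    have h1 := ((hB k x).1 hk).1.2
    have h2 := (hx k (Set.mem_univ k)).1
    linarith
  have hBd : Pairwise (Function.onFun Disjoint B) := by
    intro k l hkl
    rw [Function.onFun, Set.disjoint_left]
    intro x hk hl
    have h1 := (hB k x).1 hk
    have h2 := (hB l x).1 hl
    linarith [(h1.2 l hkl.symm).1, h1.1.2, h2.1.2]
  have hA : volume A = ENNReal.ofReal ((1/2)^(m+1)) := by
    simp only [A]
    rw [volume_pi_pi]
    simp only [Real.volume_Ioc, Finset.prod_const, Finset.card_univ, Fintype.card_fin]
    rw [← ENNReal.ofReal_pow (by norm_num)]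
    norm_num
  rw [hS, measure_union hAB (MeasurableSet.iUnion hBm), measure_iUnion hBd hBm, hA]
  simp only [hBv, tsum_fintype, Finset.sum_const, Finset.card_univ, Fintype.card_fin,
    nsmul_eq_mul]
  rw [← ENNReal.ofReal_natCast, ← ENNReal.ofReal_mul (by positivity),
    ← ENNReal.ofReal_add (by positivity) (by positivity)]
  have : ((1:ℝ)/2)^(m+1) + ((m+1 : ℕ):ℝ) * ((1/2)^(m+1)/(m+1)) = (2^m)⁻¹ := by
    push_cast
    rw [mul_div_cancel₀ _ (by positivity : (m:ℝ) + 1 ≠ 0), pow_succ, ← inv_pow]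
    ring
  rw [this, ENNReal.ofReal_inv_of_pos (by positivity), ENNReal.ofReal_pow (by norm_num)]
  simp
end

section
/- Let p ≥ 1 and let T_Y : [0,1]² → [0,1] be the Yager t-norm T_Y(a,b) = max(1 − ((1−a)^p + (1−b)^p)^{1/p}, 0). Then for all a, c ∈ [0,1], the residuum sup{ b ∈ [0,1] : T_Y(a,b) ≤ c } equals 1 if a ≤ c, and equals 1 − ((1 − c)^p − (1 − a)^p)^{1/p} if a > c. -/
/-- The R-implication (residuum) of the Yager t-norm
`T_Y(a,b) = max (1 - ((1-a)^p + (1-b)^p)^(1/p)) 0` equals `1` if `a ≤ c` and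
`1 - ((1-c)^p - (1-a)^p)^(1/p)` otherwise. -/
theorem yager_residuum (p : ℝ) (hp : 1 ≤ p) (a c : ℝ)
    (ha : a ∈ Set.Icc (0 : ℝ) 1) (hc : c ∈ Set.Icc (0 : ℝ) 1) :
    sSup {b ∈ Set.Icc (0 : ℝ) 1 |
        max (1 - ((1 - a) ^ p + (1 - b) ^ p) ^ (1 / p)) 0 ≤ c}
      = if a ≤ c then 1 else 1 - ((1 - c) ^ p - (1 - a) ^ p) ^ (1 / p) := by
  obtain ⟨ha0, ha1⟩ := ha
  obtain ⟨hc0, hc1⟩ := hc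
  have hp0 : 0 < p := by linarith
  have hA : 0 ≤ (1 - a) ^ p := Real.rpow_nonneg (by linarith) p
  have hC : 0 ≤ (1 - c) ^ p := Real.rpow_nonneg (by linarith) p
  have key : ∀ b : ℝ, b ≤ 1 →
      (max (1 - ((1 - a) ^ p + (1 - b) ^ p) ^ (1 / p)) 0 ≤ c ↔
        (1 - c) ^ p ≤ (1 - a) ^ p + (1 - b) ^ p) := by
    intro b hb
    have hB : 0 ≤ (1 - b) ^ p := Real.rpow_nonneg (by linarith) p
    rw [← Real.le_rpow_inv_iff_of_pos (by linarith) (by linarith) hp0, one_div, max_le_iff]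
    constructor
    · rintro ⟨h, _⟩
      linarith
    · intro h
      exact ⟨by linarith, hc0⟩
  apply IsGreatest.csSup_eq
  split_ifs with hac
  · refine ⟨⟨⟨zero_le_one, le_rfl⟩, ?_⟩, fun b hb => hb.1.2⟩
    rw [key 1 le_rfl]
    have h1 : (1 - c) ^ p ≤ (1 - a) ^ p :=
      Real.rpow_le_rpow (by linarith) (by linarith) hp0.le
    have h2 : (0 : ℝ) ≤ (1 - 1) ^ p := Real.rpow_nonneg (by norm_num) p
    linarith
  · have h1 : (1 - a) ^ p ≤ (1 - c) ^ p :=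
      Real.rpow_le_rpow (by linarith) (by linarith) hp0.le
    have hD : 0 ≤ (1 - c) ^ p - (1 - a) ^ p := by linarith
    have hC1 : (1 - c) ^ p ≤ 1 := Real.rpow_le_one (by linarith) (by linarith) hp0.le
    have hR : 0 ≤ ((1 - c) ^ p - (1 - a) ^ p) ^ (1 / p) := Real.rpow_nonneg hD _
    have hR1 : ((1 - c) ^ p - (1 - a) ^ p) ^ (1 / p) ≤ 1 :=
      Real.rpow_le_one hD (by linarith) (by positivity)
    refine ⟨⟨⟨by linarith, by linarith⟩, ?_⟩, ?_⟩
    · rw [key _ (by linarith), sub_sub_cancel, one_div, Real.rpow_inv_rpow hD hp0.ne']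
      linarith
    · rintro b ⟨⟨hb0, hb1⟩, hb⟩
      rw [key b hb1] at hb
      have h3 : ((1 - c) ^ p - (1 - a) ^ p) ^ p⁻¹ ≤ 1 - b := by
        rw [Real.rpow_inv_le_iff_of_pos hD (by linarith) hp0]
        linarith
      rw [one_div]
      linarith
end

section
/- Let I : [0,1]² → [0,1], let s > 0 and b₀ ∈ ℝ, and let σ_I be the I-sigmoidal operator. Then for all a, c ∈ [0,1]: σ_I(a,c) = 1 if and only if I(a,c) = 1, and σ_I(a,c) = 0 if and only if I(a,c) = 0. -/
/-- The logistic sigmoid function. -/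
noncomputable def logistic (x : ℝ) : ℝ := 1 / (1 + Real.exp (-x))

/-- The `I`-sigmoidal operator with parameters `s` and `b₀`. -/
noncomputable def sigmoidal (I : ℝ → ℝ → ℝ) (s b₀ : ℝ) (a c : ℝ) : ℝ :=
  ((1 + Real.exp (-s * (1 + b₀))) / (Real.exp (-b₀ * s) - Real.exp (-s * (1 + b₀)))) *
    ((1 + Real.exp (-b₀ * s)) * logistic (s * (I a c + b₀)) - 1)

/-- `σ_I(a,c) = 1` iff `I(a,c) = 1`, and `σ_I(a,c) = 0` iff `I(a,c) = 0`. -/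
theorem sigmoidal_eq_one_zero_iff (I : ℝ → ℝ → ℝ)
    (hI : ∀ a ∈ Set.Icc (0 : ℝ) 1, ∀ c ∈ Set.Icc (0 : ℝ) 1, I a c ∈ Set.Icc (0 : ℝ) 1)
    (s b₀ : ℝ) (hs : 0 < s)
    (a : ℝ) (ha : a ∈ Set.Icc (0 : ℝ) 1) (c : ℝ) (hc : c ∈ Set.Icc (0 : ℝ) 1) :
    (sigmoidal I s b₀ a c = 1 ↔ I a c = 1) ∧
    (sigmoidal I s b₀ a c = 0 ↔ I a c = 0) := by
  have hQP : Real.exp (-s * (1 + b₀)) < Real.exp (-b₀ * s) := by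
    apply Real.exp_lt_exp.mpr
    nlinarith
  have hEQ : Real.exp (-(s * (I a c + b₀))) = Real.exp (-s * (1 + b₀)) ↔ I a c = 1 := by
    rw [Real.exp_eq_exp]
    constructor
    · intro h
      apply mul_left_cancel₀ hs.ne'
      linarith
    · intro h
      rw [h]
      ring
  have hEP : Real.exp (-(s * (I a c + b₀))) = Real.exp (-b₀ * s) ↔ I a c = 0 := by
    rw [Real.exp_eq_exp]
    constructor
    · intro h
      apply mul_left_cancel₀ hs.ne'
      linarith
    · intro h
      rw [h]
      ring
  rw [← hEQ, ← hEP]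
  unfold sigmoidal logistic
  have hP := Real.exp_pos (-b₀ * s)
  have hQ := Real.exp_pos (-s * (1 + b₀))
  have hE := Real.exp_pos (-(s * (I a c + b₀)))
  generalize Real.exp (-b₀ * s) = P at *
  generalize Real.exp (-s * (1 + b₀)) = Q at *
  generalize Real.exp (-(s * (I a c + b₀))) = E at *
  have hD : P - Q ≠ 0 := by linarith
  have h1E : 1 + E ≠ 0 := by positivity
  have h1Q : 1 + Q ≠ 0 := by positivity
  have h1P : 1 + P ≠ 0 := by positivity
  have key : (1 + Q) / (P - Q) * ((1 + P) * (1 / (1 + E)) - 1)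
      = ((1 + Q) * (P - E)) / ((P - Q) * (1 + E)) := by
    field_simp
    ring
  rw [key, div_eq_iff (mul_ne_zero hD h1E), div_eq_iff (mul_ne_zero hD h1E)]
  constructor
  · constructor
    · intro h
      apply mul_left_cancel₀ h1P
      linarith
    · rintro rfl
      ring
  · constructor
    · intro h
      apply mul_left_cancel₀ h1Q
      linarith
    · rintro rfl
      ring
end

section
/- Let I : [0,1]² → [0,1] be a fuzzy implication, let s > 0 and b₀ ∈ ℝ, and let σ_I be the I-sigmoidal operator. Then σ_I is also a fuzzy implication; in particular σ_I maps [0,1]² into [0,1], is decreasing in its first argument, increasing in its second argument, and satisfies σ_I(0,0) = 1, σ_I(1,1) = 1 and σ_I(1,0) = 0. -/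
/-- A fuzzy implication: maps `[0,1]²` into `[0,1]`, is decreasing in the first
argument, increasing in the second argument, and satisfies the boundary conditions
`I(0,0) = 1`, `I(1,1) = 1`, `I(1,0) = 0`. -/
def IsFuzzyImplication (I : ℝ → ℝ → ℝ) : Prop :=
  (∀ a ∈ Set.Icc (0 : ℝ) 1, ∀ c ∈ Set.Icc (0 : ℝ) 1, I a c ∈ Set.Icc (0 : ℝ) 1) ∧
  (∀ c ∈ Set.Icc (0 : ℝ) 1, ∀ a₁ ∈ Set.Icc (0 : ℝ) 1, ∀ a₂ ∈ Set.Icc (0 : ℝ) 1,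
    a₁ ≤ a₂ → I a₂ c ≤ I a₁ c) ∧
  (∀ a ∈ Set.Icc (0 : ℝ) 1, ∀ c₁ ∈ Set.Icc (0 : ℝ) 1, ∀ c₂ ∈ Set.Icc (0 : ℝ) 1,
    c₁ ≤ c₂ → I a c₁ ≤ I a c₂) ∧
  I 0 0 = 1 ∧ I 1 1 = 1 ∧ I 1 0 = 0

/-- The scalar map underlying the sigmoidal operator. -/
noncomputable def sigAux (s b x : ℝ) : ℝ :=
  ((1 + Real.exp (-s * (1 + b))) / (Real.exp (-b * s) - Real.exp (-s * (1 + b)))) *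
    ((1 + Real.exp (-b * s)) * logistic (s * (x + b)) - 1)

theorem sigAux_den (s b : ℝ) (hs : 0 < s) :
    0 < Real.exp (-b * s) - Real.exp (-s * (1 + b)) := by
  rw [sub_pos, Real.exp_lt_exp]
  linarith

theorem sigAux_mono (s b : ℝ) (hs : 0 < s) {x y : ℝ} (h : x ≤ y) :
    sigAux s b x ≤ sigAux s b y := by
  have hd := sigAux_den s b hs
  have hl : logistic (s * (x + b)) ≤ logistic (s * (y + b)) := by
    unfold logistic
    gcongr
  unfold sigAux
  gcongr

theorem sigAux_zero (s b : ℝ) : sigAux s b 0 = 0 := by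
  have e : -(s * (0 + b)) = -b * s := by ring
  have hp : 1 + Real.exp (-b * s) ≠ 0 := by positivity
  unfold sigAux logistic
  rw [e, mul_one_div_cancel hp, sub_self, mul_zero]

theorem sigAux_one (s b : ℝ) (hs : 0 < s) : sigAux s b 1 = 1 := by
  have e : -(s * (1 + b)) = -s * (1 + b) := by ring
  have hd := (sigAux_den s b hs).ne'
  have hp : 1 + Real.exp (-s * (1 + b)) ≠ 0 := by positivity
  unfold sigAux logistic
  rw [e]
  generalize Real.exp (-s * (1 + b)) = B at *
  generalize Real.exp (-b * s) = A at *
  field_simp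
  ring

/-- If `I` is a fuzzy implication then so is the `I`-sigmoidal operator `σ_I`. -/
theorem sigmoidal_isFuzzyImplication (I : ℝ → ℝ → ℝ) (hI : IsFuzzyImplication I)
    (s b₀ : ℝ) (hs : 0 < s) :
    IsFuzzyImplication (sigmoidal I s b₀) := by
  obtain ⟨h01, hdec, hinc, h00, h11, h10⟩ := hI
  have key : ∀ a c, sigmoidal I s b₀ a c = sigAux s b₀ (I a c) := fun _ _ => rfl
  simp only [IsFuzzyImplication, key, h00, h11, h10, sigAux_zero, sigAux_one s b₀ hs, and_self,
    and_true]
  refine ⟨fun a ha c hc => ⟨?_, ?_⟩, fun c hc a₁ h₁ a₂ h₂ h => ?_, fun a ha c₁ h₁ c₂ h₂ h => ?_⟩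
  · rw [← sigAux_zero s b₀]
    exact sigAux_mono s b₀ hs (h01 a ha c hc).1
  · rw [← sigAux_one s b₀ hs]
    exact sigAux_mono s b₀ hs (h01 a ha c hc).2
  · exact sigAux_mono s b₀ hs (hdec c hc a₁ h₁ a₂ h₂ h)
  · exact sigAux_mono s b₀ hs (hinc a ha c₁ h₁ c₂ h₂ h)
end

section
/- For every p ≥ 1, the two-dimensional Lebesgue measure of the set {(a,b) ∈ [0,1]² : (1 − a)^p + (1 − b)^p ≤ 1} equals √π · 4^{−1/p} · Γ(1/p) / (p · Γ(1/2 + 1/p)), where Γ is the Gamma function. -/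
open MeasureTheory

lemma yager_half {f : ℝ × ℝ → ℝ × ℝ} (hf : MeasurePreserving f volume volume)
    {A H : Set (ℝ × ℝ)} (hA : MeasurableSet A) (hH : MeasurableSet H)
    (hfA : f ⁻¹' A = A) (hfH : f ⁻¹' H =ᵐ[volume] (Hᶜ : Set (ℝ × ℝ))) :
    volume A = 2 * volume (A ∩ H) := by
  have h1 : volume (A ∩ Hᶜ) = volume (A ∩ H) := by
    rw [← hf.measure_preimage (hA.inter hH).nullMeasurableSet, Set.preimage_inter, hfA]
    exact measure_congr ((ae_eq_refl A).inter hfH.symm)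
  rw [← measure_inter_add_sdiff A hH, Set.sdiff_eq, h1, two_mul]

lemma yager_neg : MeasurePreserving (fun x : ℝ => -x) volume volume :=
  Measure.measurePreserving_neg volume

lemma yager_neg1 : MeasurePreserving (fun x : ℝ × ℝ => (-x.1, x.2)) volume volume :=
  yager_neg.prod (MeasurePreserving.id volume)

lemma yager_neg2 : MeasurePreserving (fun x : ℝ × ℝ => (x.1, -x.2)) volume volume :=
  (MeasurePreserving.id volume).prod yager_neg

lemma yager_refl : MeasurePreserving (fun x : ℝ × ℝ => (1 - x.1, 1 - x.2)) volume volume :=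
  (Measure.measurePreserving_sub_left volume (1 : ℝ)).prod (Measure.measurePreserving_sub_left volume (1 : ℝ))

lemma yager_null1 : volume {x : ℝ × ℝ | x.1 = 0} = 0 := by
  have : {x : ℝ × ℝ | x.1 = 0} = {0} ×ˢ Set.univ := by ext; simp
  rw [this, Measure.volume_eq_prod, Measure.prod_prod]; simp

lemma yager_null2 : volume {x : ℝ × ℝ | x.2 = 0} = 0 := by
  have : {x : ℝ × ℝ | x.2 = 0} = Set.univ ×ˢ {0} := by ext; simp
  rw [this, Measure.volume_eq_prod, Measure.prod_prod]; simp

lemma yager_disk (p : ℝ) (hp : 1 ≤ p) :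
    volume {x : ℝ × ℝ | |x.1| ^ p + |x.2| ^ p ≤ 1} =
      ENNReal.ofReal ((2 * Real.Gamma (1 / p + 1)) ^ 2 / Real.Gamma (2 / p + 1)) := by
  have h := volume_sum_rpow_le (Fin 2) hp 1
  have hm := volume_preserving_finTwoArrow ℝ
  rw [← hm.measure_preimage_equiv]
  simp only [ENNReal.ofReal_one, one_pow, one_mul, Fintype.card_fin, Nat.cast_ofNat] at h
  rw [← h]
  congr 1
  ext x
  have h0 : 0 ≤ |x 0| ^ p + |x 1| ^ p := by positivity
  simp [MeasurableEquiv.finTwoArrow, Fin.sum_univ_two]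
  have := Real.rpow_le_rpow_iff h0 zero_le_one (inv_pos.2 (show 0 < p by linarith))
  rw [Real.one_rpow] at this
  exact this.symm

theorem volume_yager_tnorm_nonvanishing (p : ℝ) (hp : 1 ≤ p) :
    volume {x : ℝ × ℝ | x.1 ∈ Set.Icc (0 : ℝ) 1 ∧ x.2 ∈ Set.Icc (0 : ℝ) 1 ∧
        (1 - x.1) ^ p + (1 - x.2) ^ p ≤ 1}
      = ENNReal.ofReal
          (Real.sqrt Real.pi * (4 : ℝ) ^ (-(1 / p)) * Real.Gamma (1 / p) /
            (p * Real.Gamma (1 / 2 + 1 / p))) := by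
  have hp0 : 0 < p := by linarith
  set D : Set (ℝ × ℝ) := {x : ℝ × ℝ | |x.1| ^ p + |x.2| ^ p ≤ 1} with hD
  have hDm : MeasurableSet D := measurableSet_le (by fun_prop) (by fun_prop)
  have hH1 : MeasurableSet {x : ℝ × ℝ | 0 ≤ x.1} := measurableSet_le (by fun_prop) (by fun_prop)
  have hH2 : MeasurableSet {x : ℝ × ℝ | 0 ≤ x.2} := measurableSet_le (by fun_prop) (by fun_prop)
  have e1 := yager_half yager_neg1 hDm hH1 (by ext x; simp [hD]) (by
    have : ∀ᵐ x : ℝ × ℝ, x.1 ≠ 0 := by rw [ae_iff]; simpa using yager_null1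
    filter_upwards [this] with x hx
    apply propext
    change 0 ≤ -x.1 ↔ ¬ (0 ≤ x.1)
    grind)
  have e2 := yager_half yager_neg2 (hDm.inter hH1) hH2 (by ext x; simp [hD]) (by
    have : ∀ᵐ x : ℝ × ℝ, x.2 ≠ 0 := by rw [ae_iff]; simpa using yager_null2
    filter_upwards [this] with x hx
    apply propext
    change 0 ≤ -x.2 ↔ ¬ (0 ≤ x.2)
    grind)
  have e3 : {x : ℝ × ℝ | x.1 ∈ Set.Icc (0 : ℝ) 1 ∧ x.2 ∈ Set.Icc (0 : ℝ) 1 ∧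
        (1 - x.1) ^ p + (1 - x.2) ^ p ≤ 1} = (fun x : ℝ × ℝ => (1 - x.1, 1 - x.2)) ⁻¹'
        (D ∩ {x | 0 ≤ x.1} ∩ {x | 0 ≤ x.2}) := by
    ext ⟨a, b⟩
    simp only [hD, Set.mem_ofPred_eq, Set.mem_Icc, Set.mem_preimage, Set.mem_inter_iff]
    constructor
    · rintro ⟨⟨h1, h2⟩, ⟨h3, h4⟩, h5⟩
      rw [abs_of_nonneg (by linarith), abs_of_nonneg (by linarith)]
      exact ⟨⟨h5, by linarith⟩, by linarith⟩
    · rintro ⟨⟨h5, h1⟩, h2⟩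
      rw [abs_of_nonneg h1, abs_of_nonneg h2] at h5
      have u := Real.rpow_nonneg h1 p
      have v := Real.rpow_nonneg h2 p
      have a1 : 1 - a ≤ 1 := by
        by_contra! h
        linarith [Real.one_lt_rpow h hp0]
      have b1 : 1 - b ≤ 1 := by
        by_contra! h
        linarith [Real.one_lt_rpow h hp0]
      exact ⟨⟨by linarith, by linarith⟩, ⟨by linarith, by linarith⟩, h5⟩
  rw [e3, yager_refl.measure_preimage ((hDm.inter hH1).inter hH2).nullMeasurableSet]
  rw [e2, yager_disk p hp] at e1
  have hs : 0 < 1 / p := by positivity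
  have g1 := Real.Gamma_pos_of_pos hs
  have g2 : 0 < Real.Gamma (1 / 2 + 1 / p) := Real.Gamma_pos_of_pos (by positivity)
  have g3 : 0 < Real.Gamma (2 * (1 / p)) := Real.Gamma_pos_of_pos (by positivity)
  have key : (2 * Real.Gamma (1 / p + 1)) ^ 2 / Real.Gamma (2 / p + 1) =
      2 * (2 * (Real.sqrt Real.pi * (4 : ℝ) ^ (-(1 / p)) * Real.Gamma (1 / p) /
            (p * Real.Gamma (1 / 2 + 1 / p)))) := by
    have d := Real.Gamma_mul_Gamma_add_half (1 / p)
    have h4 : (2 : ℝ) ^ (1 - 2 * (1 / p)) = 2 * (4 : ℝ) ^ (-(1 / p)) := by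
      rw [show (4 : ℝ) = 2 ^ (2 : ℝ) by norm_num, ← Real.rpow_mul (by norm_num),
        sub_eq_add_neg, Real.rpow_add (by norm_num), Real.rpow_one]
      congr 2
      ring
    rw [h4, add_comm (1 / p) (1 / 2)] at d
    rw [show 2 / p = 2 * (1 / p) by ring, Real.Gamma_add_one hs.ne',
      Real.Gamma_add_one (by positivity)]
    generalize Real.Gamma (1 / p) = G at *
    generalize Real.Gamma (1 / 2 + 1 / p) = K at *
    generalize Real.Gamma (2 * (1 / p)) = L at *
    generalize (4 : ℝ) ^ (-(1 / p)) = F at *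
    field_simp
    linear_combination d
  rw [key, ENNReal.ofReal_mul (by norm_num), ENNReal.ofReal_mul (by norm_num)] at e1
  simp only [ENNReal.ofReal_ofNat] at e1
  have c : ∀ x y : ENNReal, 2 * x = 2 * y → x = y := fun x y h =>
    (ENNReal.mul_right_inj (by norm_num) (by norm_num)).1 h
  exact (c _ _ (c _ _ e1)).symm
end
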